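/- arXiv:2308.04513 — 2 statements merged into one kernel-verified Lean document; each statement's English description precedes it below -/
import Mathlib

section
/- For every real skew-symmetric n×n matrix M there exists an invertible real matrix P such that P M Pᵀ is the direct sum of rank(M)/2 copies of the 2×2 block [[0,-1],[1,0]] and (n - rank M) copies of the 1×1 zero block. -/
open Matrix in
/-- The canonical skew form. -/
def skewJ (n r : ℕ) : Matrix (Fin n) (Fin n) ℝ :=
  Matrix.of (fun i j : Fin n =>
        if (j : ℕ) = (i : ℕ) + 1 ∧ (i : ℕ) % 2 = 0 ∧ (j : ℕ) < r then (-1 : ℝ)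
        else if (i : ℕ) = (j : ℕ) + 1 ∧ (j : ℕ) % 2 = 0 ∧ (i : ℕ) < r then 1
        else 0)

theorem skewJ_block (m r : ℕ) :
    (skewJ (2 + m) (r + 2)).submatrix finSumFinEquiv finSumFinEquiv
      = Matrix.fromBlocks !![0, -1; 1, 0] 0 0 (skewJ m r) := by
  ext i j
  rcases i with i | i <;> rcases j with j | j
  · fin_cases i <;> fin_cases j <;> simp [skewJ]
  · have := i.2
    simp [skewJ]
    grind
  · have := j.2
    simp [skewJ]
    grind
  · simp only [skewJ, Matrix.submatrix_apply, Matrix.of_apply, finSumFinEquiv_apply_right,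
      Fin.val_natAdd, Matrix.fromBlocks_apply₂₂]
    congr 1
    · apply propext; omega
    · congr 1
      apply propext; omega

theorem skewJ_zero (n : ℕ) : skewJ n 0 = 0 := by
  ext i j
  simp [skewJ]

open Matrix in
theorem skewJ_rank (k : ℕ) : ∀ n, 2 * k ≤ n → (skewJ n (2 * k)).rank = 2 * k := by
  have key : ∀ n, 2 * k ≤ n → (skewJ n (2 * k))ᵀ * skewJ n (2 * k)
      = diagonal (fun i : Fin n => if (i : ℕ) < 2 * k then (1 : ℝ) else 0) := by
    induction k with
    | zero => intro n _; simp [skewJ_zero]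
    | succ k ih =>
      intro n hn
      obtain ⟨m, rfl⟩ : ∃ m, n = 2 + m := ⟨n - 2, by omega⟩
      have h := ih m (by omega)
      apply (Matrix.reindex finSumFinEquiv.symm finSumFinEquiv.symm).injective
      simp only [Matrix.reindex_apply, Equiv.symm_symm]
      rw [← Matrix.submatrix_mul_equiv _ _ _ finSumFinEquiv, ← Matrix.transpose_submatrix,
        show 2 * (k + 1) = 2 * k + 2 by ring, skewJ_block, fromBlocks_transpose,
        fromBlocks_multiply]
      simp only [h]
      ext i j
      rcases i with i | i <;> rcases j with j | j
      · fin_cases i <;> fin_cases j <;> simp [diagonal, Matrix.mul_apply, Fin.sum_univ_two]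
      · have := i.2
        simp [diagonal, Fin.ext_iff]
        grind
      · have := j.2
        simp [diagonal, Fin.ext_iff]
        grind
      · simp [diagonal, Fin.ext_iff]
        grind
  intro n hn
  rw [← rank_transpose_mul_self, key n hn, rank_diagonal]
  simp only [ne_eq, ite_eq_right_iff, one_ne_zero, imp_false, not_not]
  rw [Fintype.card_subtype, Fin.card_filter_val_lt]
  omega

open Matrix in
theorem skew_block_step {m : ℕ} (a : ℝ) (ha : a ≠ 0) (B : Matrix (Fin 2) (Fin m) ℝ)
    (D : Matrix (Fin m) (Fin m) ℝ) (hD : Dᵀ = -D) (k : ℕ)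
    (ih : ∀ N : Matrix (Fin m) (Fin m) ℝ, Nᵀ = -N →
      ∃ P : Matrix (Fin m) (Fin m) ℝ, IsUnit P ∧ ∃ k, 2 * k ≤ m ∧ P * N * Pᵀ = skewJ m (2 * k)) :
    ∃ P : Matrix (Fin 2 ⊕ Fin m) (Fin 2 ⊕ Fin m) ℝ, IsUnit P ∧ ∃ k, 2 * k ≤ m ∧
      P * fromBlocks !![0, a; -a, 0] B (-Bᵀ) D * Pᵀ
        = fromBlocks !![0, -1; 1, 0] 0 0 (skewJ m (2 * k)) := by
  obtain ⟨A, hA⟩ : ∃ A : Matrix (Fin 2) (Fin 2) ℝ, A = !![0, a; -a, 0] := ⟨_, rfl⟩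
  obtain ⟨Ai, hAi⟩ : ∃ A : Matrix (Fin 2) (Fin 2) ℝ, A = !![0, -1/a; 1/a, 0] := ⟨_, rfl⟩
  obtain ⟨Q, hQ⟩ : ∃ A : Matrix (Fin 2) (Fin 2) ℝ, A = !![-1/a, 0; 0, 1] := ⟨_, rfl⟩
  have hAAi : A * Ai = 1 := by
    subst hA hAi
    ext i j; fin_cases i <;> fin_cases j <;> simp [Matrix.mul_apply, Fin.sum_univ_two] <;>
      field_simp
  have hAiA : Ai * A = 1 := mul_eq_one_comm.mp hAAi
  have hAit : Aiᵀ = -Ai := by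
    subst hAi
    ext i j; fin_cases i <;> fin_cases j <;> simp <;> ring
  have hQA : Q * A * Qᵀ = !![0, -1; 1, 0] := by
    subst hA hQ
    ext i j; fin_cases i <;> fin_cases j <;>
      simp [Matrix.mul_apply, Fin.sum_univ_two] <;> field_simp
  have hQu : IsUnit Q := by
    rw [isUnit_iff_isUnit_det, hQ, det_fin_two]
    simp [ha]
  obtain ⟨P, hP, k, hk, hPk⟩ := ih (Bᵀ * Ai * B + D) (by
    simp only [transpose_add, transpose_mul, transpose_transpose, hAit, hD]
    simp [Matrix.mul_assoc, add_comm])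
  refine ⟨fromBlocks Q 0 0 P * fromBlocks 1 0 (Bᵀ * Ai) 1, ?_, k, hk, ?_⟩
  · rw [isUnit_iff_isUnit_det] at *
    rw [det_mul, det_fromBlocks_zero₁₂, det_fromBlocks_zero₁₂]
    simpa using ⟨by simpa using hQu, by simpa using hP⟩
  · rw [← hA]
    have h1 : fromBlocks 1 0 (Bᵀ * Ai) 1 * fromBlocks A B (-Bᵀ) D *
        (fromBlocks 1 0 (Bᵀ * Ai) 1)ᵀ = fromBlocks A 0 0 (Bᵀ * Ai * B + D) := by
      rw [fromBlocks_transpose, fromBlocks_multiply, fromBlocks_multiply]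
      have e1 : Bᵀ * Ai * A = Bᵀ := by rw [Matrix.mul_assoc, hAiA, Matrix.mul_one]
      have e2 : A * (Bᵀ * Ai)ᵀ = -B := by
        rw [transpose_mul, hAit, transpose_transpose, ← Matrix.mul_assoc, Matrix.mul_neg, hAAi]
        simp
      simp [e1, e2, -transpose_mul]
    calc _ = fromBlocks Q 0 0 P * (fromBlocks 1 0 (Bᵀ * Ai) 1 * fromBlocks A B (-Bᵀ) D *
        (fromBlocks 1 0 (Bᵀ * Ai) 1)ᵀ) * (fromBlocks Q 0 0 P)ᵀ := by
          simp only [transpose_mul, Matrix.mul_assoc]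
      _ = _ := by
        rw [h1, fromBlocks_transpose, fromBlocks_multiply, fromBlocks_multiply]
        simp [hQA, hPk]

open Matrix in
theorem skew_normal_form (n : ℕ) : ∀ M : Matrix (Fin n) (Fin n) ℝ, Mᵀ = -M →
    ∃ P : Matrix (Fin n) (Fin n) ℝ, IsUnit P ∧ ∃ k, 2 * k ≤ n ∧ P * M * Pᵀ = skewJ n (2 * k) := by
  induction n using Nat.strong_induction_on with
  | _ n IH =>
  intro M hM
  by_cases h0 : M = 0
  · exact ⟨1, isUnit_one, 0, by omega, by simp [h0, skewJ_zero]⟩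
  have hs : ∀ i j, M j i = - M i j := fun i j => congrFun (congrFun hM i) j
  obtain ⟨i, j, hij⟩ : ∃ i j, M i j ≠ 0 := by
    by_contra! h
    exact h0 (by ext i j; simp [h])
  have hne : j ≠ i := by
    rintro rfl
    have := hs j j
    exact hij (by linarith)
  obtain ⟨m, rfl⟩ : ∃ m, n = 2 + m := ⟨n - 2, by
    have := i.2; have := j.2; have : (j : ℕ) ≠ i := fun h => hne (Fin.ext h)
    omega⟩
  obtain ⟨e, he0, he1⟩ : ∃ e : Fin 2 ⊕ Fin m ≃ Fin (2 + m),
      e (Sum.inl 0) = i ∧ e (Sum.inl 1) = j := by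
    obtain ⟨f, hf⟩ : ∃ f : Fin 2 ⊕ Fin m ≃ Fin (2 + m), f = finSumFinEquiv := ⟨_, rfl⟩
    have h01 : f (Sum.inl 0) ≠ f (Sum.inl 1) := by simp
    have hj : Equiv.swap (f (Sum.inl 0)) i j ≠ f (Sum.inl 0) := by
      intro h
      rw [Equiv.swap_apply_eq_iff, Equiv.swap_apply_left] at h
      exact hne h
    refine ⟨f.trans ((Equiv.swap (f (Sum.inl 1)) (Equiv.swap (f (Sum.inl 0)) i j)).trans
      (Equiv.swap (f (Sum.inl 0)) i)), ?_, ?_⟩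
    · simp only [Equiv.trans_apply]
      rw [Equiv.swap_apply_of_ne_of_ne h01 hj.symm, Equiv.swap_apply_left]
    · simp only [Equiv.trans_apply]
      rw [Equiv.swap_apply_left, Equiv.swap_apply_self]
  have hblk : M.submatrix e e = fromBlocks !![0, M i j; -M i j, 0]
      (M.submatrix e e).toBlocks₁₂ (-(M.submatrix e e).toBlocks₁₂ᵀ)
      (M.submatrix e e).toBlocks₂₂ := by
    have hd : ∀ i, M i i = 0 := fun i => by have := hs i i; linarith
    ext p q
    rcases p with p | p <;> rcases q with q | q
    · fin_cases p <;> fin_cases q <;> simp [he0, he1, hd, hs i j]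
    · simp [toBlocks₁₂]
    · simp [toBlocks₁₂, hs (e (Sum.inl q))]
    · simp [toBlocks₂₂]
  obtain ⟨P, hP, k, hk, hPk⟩ := skew_block_step (M i j) hij (M.submatrix e e).toBlocks₁₂
    (M.submatrix e e).toBlocks₂₂ (by ext p q; simp [toBlocks₂₂, hs (e (Sum.inr p))]) 0
    (IH m (by omega))
  rw [← hblk, ← skewJ_block] at hPk
  refine ⟨P.submatrix finSumFinEquiv.symm e.symm, ?_, k + 1, by omega, ?_⟩
  · rw [isUnit_submatrix_equiv]
    exact hP
  · have := congrArg (fun N => N.submatrix finSumFinEquiv.symm finSumFinEquiv.symm) hPk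
    simp only [submatrix_submatrix, Equiv.self_comp_symm, submatrix_id_id] at this
    rw [show 2 * (k + 1) = 2 * k + 2 by ring, ← this,
      ← Matrix.submatrix_mul_equiv _ _ _ e.symm, ← Matrix.submatrix_mul_equiv _ _ _ e.symm]
    simp

open Matrix in
theorem skew_symmetric_inertia (n : ℕ) (M : Matrix (Fin n) (Fin n) ℝ)
    (hM : Mᵀ = -M) :
    ∃ P : Matrix (Fin n) (Fin n) ℝ, IsUnit P ∧
      P * M * Pᵀ = Matrix.of (fun i j : Fin n =>
        if (j : ℕ) = (i : ℕ) + 1 ∧ (i : ℕ) % 2 = 0 ∧ (j : ℕ) < M.rank then (-1 : ℝ)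
        else if (i : ℕ) = (j : ℕ) + 1 ∧ (j : ℕ) % 2 = 0 ∧ (i : ℕ) < M.rank then 1
        else 0) := by
  obtain ⟨P, hP, k, hk, h⟩ := skew_normal_form n M hM
  refine ⟨P, hP, ?_⟩
  have hr : M.rank = 2 * k := by
    have hd := (isUnit_iff_isUnit_det _).1 hP
    rw [← skewJ_rank k n hk, ← h, rank_mul_eq_left_of_isUnit_det _ _ (by rwa [det_transpose]),
      rank_mul_eq_right_of_isUnit_det _ _ hd]
  rw [hr]
  exact h
end

section
/- Cancellation property implies the decomposition-uniqueness conjecture: Let 𝒜 be a finite-dimensional local ℝ-*-algebra such that self-adjoint matrices over 𝒜 satisfy the cancellation property under unitary similarity (if A is unitarily similar to A' and A ⊕ B is unitarily similar to A' ⊕ B', then B is unitarily similar to B'). Then for every self-adjoint H ∈ M_n(𝒜), any two maximal-length decompositions H = Σ_{i=1}^k P_i H P_i = Σ_{i=1}^k Q_i H Q_i into nonzero self-adjoint orthogonal idempotents are related by a unitary U ∈ M_n(𝒜) with U H U* = H and U Q_i U* = P_{σ(i)} for some permutation σ. -/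
open Matrix

/-- Unitary similarity of matrices over a `*`-ring. -/
def UnitarilySimilar {R : Type} [Ring R] [StarRing R] {m : Type} [Fintype m] [DecidableEq m]
    (A B : Matrix m m R) : Prop :=
  ∃ U : Matrix m m R, Uᴴ * U = 1 ∧ U * Uᴴ = 1 ∧ U * A * Uᴴ = B

/-- A field whose proper finite extensions have all square roots, and in which `1` is not a sum of
elements none of which is a nonzero square. -/
def GoodField (K : Type) [Field K] : Prop :=
  (∀ (L : Type) [Field L] [Algebra K L] [FiniteDimensional K L],
    Function.Surjective (algebraMap K L) ∨ ∀ x : L, ∃ y, y * y = x) ∧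
  (∀ (k : ℕ) (l : Fin k → K), ∑ i, l i = 1 → ∃ j, l j ≠ 0 ∧ ∃ y, y * y = l j)

theorem goodField_of_involution (K F : Type) [Field K] [Field F] [CharZero F] [IsAlgClosed F]
    (f : K →+* F) (τ : F →+* F) (hτ : ∀ x, τ (τ x) = x)
    (hfix : ∀ x, τ x = x ↔ ∃ y, f y = x) : GoodField K := by
  classical
  constructor
  · intro L _ _ _
    let _ : Algebra K F := f.toAlgebra
    let g : L →ₐ[K] F := IsAlgClosed.lift
    by_cases hs : Function.Surjective (algebraMap K L)
    · exact Or.inl hs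
    right
    have ginj : ∀ a b, g a = g b → a = b := fun a b h => g.toRingHom.injective h
    have hgf : ∀ k, g (algebraMap K L k) = f k := fun k => g.commutes k
    simp only [Function.Surjective, not_forall] at hs
    obtain ⟨y, hy⟩ := hs
    have hty : τ (g y) ≠ g y := by
      intro h
      obtain ⟨k, hk⟩ := (hfix _).1 h
      exact hy ⟨k, ginj _ _ (by rw [hgf, hk])⟩
    have hsne : g y - τ (g y) ≠ 0 := fun h => hty (sub_eq_zero.1 h).symm
    obtain ⟨p, hp⟩ := (hfix (g y + τ (g y))).1 (by simp [hτ, add_comm])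
    have hgs : Function.Surjective g := by
      intro x
      obtain ⟨u, hu⟩ := (hfix ((x + τ x) / 2)).1
        (by rw [map_div₀, map_add, hτ, map_ofNat, add_comm])
      obtain ⟨v, hv⟩ := (hfix ((x - τ x) / (2 * (g y - τ (g y))))).1 (by
        simp only [map_div₀, map_sub, map_mul, hτ, map_ofNat]
        rw [← neg_sub x, ← neg_sub (g y)]
        rw [mul_neg, neg_div_neg_eq])
      refine ⟨algebraMap K L u + algebraMap K L v * (2 * y - algebraMap K L p), ?_⟩
      simp only [map_add, map_mul, map_sub, hgf, hu, hv, hp, map_ofNat]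
      field_simp
      ring
    intro x
    obtain ⟨z, hz⟩ := IsAlgClosed.exists_pow_nat_eq (g x) (n := 2) (by norm_num)
    obtain ⟨w, rfl⟩ := hgs z
    exact ⟨w, ginj _ _ (by rw [map_mul, ← hz, sq])⟩
  · intro k l hl
    have sqrt : ∀ x : F, ∃ z, z * z = x := fun x => by
      obtain ⟨z, hz⟩ := IsAlgClosed.exists_pow_nat_eq x (n := 2) (by norm_num)
      exact ⟨z, by rw [← hz, sq]⟩
    by_contra! hno
    have hlne : ∃ j, l j ≠ 0 := by
      by_contra! h
      simp [h] at hl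
    by_cases hid : ∀ x, τ x = x
    · obtain ⟨j, hj⟩ := hlne
      obtain ⟨z, hz⟩ := sqrt (f (l j))
      obtain ⟨w, rfl⟩ := (hfix z).1 (hid z)
      exact hno j hj w (f.injective (by rw [map_mul, hz]))
    push Not at hid
    obtain ⟨y, hy⟩ := hid
    have hs : ∃ s : F, s ≠ 0 ∧ τ s = -s :=
      ⟨y - τ y, fun h => hy (sub_eq_zero.1 h).symm, by simp [hτ]⟩
    obtain ⟨s, hs0, hsτ⟩ := hs
    obtain ⟨r, hr⟩ := sqrt s
    have hr0 : r ≠ 0 := by rintro rfl; simp at hr; exact hs0 hr.symm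
    have hI : ∃ I : F, I * I = -1 ∧ τ I = -I := by
      refine ⟨s / (r * τ r), ?_, ?_⟩
      · have h1 : τ r * τ r = -s := by rw [← map_mul, hr, hsτ]
        have h2 : (r * τ r) * (r * τ r) = - (s * s) := by
          calc (r * τ r) * (r * τ r) = (r * r) * (τ r * τ r) := by ring
            _ = _ := by rw [hr, h1]; ring
        rw [div_mul_div_comm, h2, div_neg, div_self (mul_ne_zero hs0 hs0)]
      · rw [map_div₀, map_mul, hτ, hsτ, mul_comm (τ r), neg_div]
    obtain ⟨I, hI, hIτ⟩ := hI
    have hI0 : I ≠ 0 := by rintro rfl; simp at hI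
    have reps : ∀ z : F, ∃ p q : K, z = f p + f q * I := by
      intro z
      obtain ⟨p, hp⟩ := (hfix ((z + τ z) / 2)).1
        (by rw [map_div₀, map_add, hτ, map_ofNat, add_comm])
      obtain ⟨q, hq⟩ := (hfix ((z - τ z) / (2 * I))).1 (by
        simp only [map_div₀, map_sub, map_mul, hτ, map_ofNat, hIτ]
        rw [← neg_sub z, mul_neg, neg_div_neg_eq])
      refine ⟨p, q, ?_⟩
      rw [hp, hq]; field_simp; ring
    have hfτ : ∀ k, τ (f k) = f k := fun k => (hfix _).2 ⟨k, rfl⟩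
    have hneg1 : ∀ y : K, y * y ≠ -1 := by
      intro y hy
      have : (f y - I) * (f y + I) = 0 := by
        have : f y * f y = -1 := by rw [← map_mul, hy]; simp
        linear_combination this - hI
      have h2 : τ I = I := by
        rcases mul_eq_zero.1 this with h | h
        · rw [← sub_eq_zero.1 h]; exact hfτ _
        · rw [eq_neg_of_add_eq_zero_right h]; rw [map_neg, hfτ]
      rw [hIτ] at h2
      exact hI0 (by linear_combination (-1/2 : F) * h2)
    have huniq : ∀ a b c d : K, f a + f b * I = f c + f d * I → a = c ∧ b = d := by
      intro a b c d h
      have h' := congrArg τ h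
      simp only [map_add, map_mul, hfτ, hIτ] at h'
      have h1 : f a = f c := by linear_combination (1/2 : F) * h + (1/2 : F) * h'
      have h2 : f b * I = f d * I := by linear_combination (1/2 : F) * h - (1/2 : F) * h'
      exact ⟨f.injective h1, f.injective (mul_right_cancel₀ hI0 h2)⟩
    have hpm : ∀ x : K, (∃ y, y * y = x) ∨ ∃ y, y * y = -x := by
      intro x
      obtain ⟨z, hz⟩ := sqrt (f x)
      obtain ⟨p, q, rfl⟩ := reps z
      have h0 : f (p * p - q * q) + f (2 * p * q) * I = f x + f 0 * I := by
        simp only [map_sub, map_mul, map_zero, map_ofNat]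
        linear_combination hz - f q * f q * hI
      obtain ⟨h1, h2⟩ := huniq _ _ _ _ h0
      have h20 : (2 : K) ≠ 0 := fun h => by
        have := congrArg f h; rw [map_ofNat, map_zero] at this; exact two_ne_zero this
      rcases mul_eq_zero.1 h2 with h | h
      · rcases mul_eq_zero.1 h with h | h
        · exact absurd h h20
        · right; exact ⟨q, by rw [← h1, h]; ring⟩
      · left; exact ⟨p, by rw [← h1, h]; ring⟩
    have hsum2 : ∀ a b : K, (∃ y, y * y = a) → (∃ y, y * y = b) → ∃ y, y * y = a + b := by
      rintro _ _ ⟨x, rfl⟩ ⟨y, rfl⟩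
      obtain ⟨z, hz⟩ := sqrt (f x + f y * I)
      obtain ⟨p, q, rfl⟩ := reps z
      have h0 : f (p * p - q * q) + f (2 * p * q) * I = f x + f y * I := by
        simp only [map_sub, map_mul, map_ofNat]
        linear_combination hz - f q * f q * hI
      obtain ⟨rfl, rfl⟩ := huniq _ _ _ _ h0
      exact ⟨p * p + q * q, by ring⟩
    have hall : ∀ s : Finset (Fin k), ∃ y, y * y = ∑ i ∈ s, - l i := by
      intro s
      induction s using Finset.induction_on with
      | empty => exact ⟨0, by simp⟩
      | insert a s ha ih =>
        rw [Finset.sum_insert ha]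
        refine hsum2 _ _ ?_ ih
        by_cases h0 : l a = 0
        · exact ⟨0, by simp [h0]⟩
        rcases hpm (l a) with ⟨y, h⟩ | h
        · exact absurd h (hno a h0 y)
        · exact h
    obtain ⟨y, hy⟩ := hall Finset.univ
    rw [Finset.sum_neg_distrib, hl] at hy
    exact hneg1 y hy

theorem coeff_field (Z : Type) [CommRing Z] [IsLocalRing Z] [Algebra ℝ Z] [FiniteDimensional ℝ Z]
    (τ : Z →+* Z) (hτ : ∀ x, τ (τ x) = x) :
    ∃ (K : Type) (_ : Field K) (s : K →+* Z), CharZero K ∧ GoodField K ∧ (∀ k, τ (s k) = s k) ∧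
      ∃ t, ∀ z, ∃ k₁ k₂, z - (s k₁ + s k₂ * t) ∈ IsLocalRing.maximalIdeal Z := by
  classical
  have : IsArtinianRing Z := IsArtinianRing.of_finite ℝ Z
  let Z0 : Subring Z := RingHom.eqLocus τ (RingHom.id Z)
  have hZ0 : ∀ z : Z, z ∈ Z0 ↔ τ z = z := fun z => Iff.rfl
  have hunit : ∀ z : Z0, IsUnit (z : Z) → IsUnit z := by
    rintro ⟨z, hz⟩ hu
    obtain ⟨w, hw⟩ := hu.exists_right_inv
    have hw' : τ w = w := by
      apply hu.mul_left_cancel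
      show z * τ w = z * w
      have := congrArg τ hw
      rw [map_mul, (hZ0 z).1 hz, map_one] at this
      rw [this]; exact hw.symm
    exact IsUnit.of_mul_eq_one ⟨w, hw'⟩ (Subtype.ext hw)
  have : IsLocalRing Z0 := IsLocalRing.of_isUnit_or_isUnit_one_sub_self fun a => by
    rcases IsLocalRing.isUnit_or_isUnit_one_sub_self (a : Z) with h | h
    · exact Or.inl (hunit _ h)
    · exact Or.inr (hunit _ (by simpa using h))
  have : IsLocalHom Z0.subtype := ⟨fun z hz => hunit z hz⟩
  have : IsLocalHom τ := ⟨fun z hz => by rw [← hτ z]; exact hz.map τ⟩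
  let q : ℚ →+* Z := (algebraMap ℝ Z).comp (algebraMap ℚ ℝ)
  let q0 : ℚ →+* Z0 := q.codRestrict Z0 (fun x => by
    show (τ.comp q) x = q x
    rw [Subsingleton.elim (τ.comp q) q])
  let _ : Algebra ℚ Z0 := q0.toAlgebra
  let K := IsLocalRing.ResidueField Z0
  let F := IsLocalRing.ResidueField Z
  let resK := IsLocalRing.residue Z0
  let resF := IsLocalRing.residue Z
  have hKc : CharZero K := by
    have := (resK.comp q0).injective
    exact charZero_of_injective_ringHom this
  let f : K →+* F := IsLocalRing.ResidueField.map Z0.subtype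
  let τ0 : F →+* F := IsLocalRing.ResidueField.map τ
  have hf : ∀ z : Z0, f (resK z) = resF z := fun z => rfl
  have hτ0 : ∀ z : Z, τ0 (resF z) = resF (τ z) := fun z => rfl
  have hτ00 : ∀ x : F, τ0 (τ0 x) = x := by
    intro x
    obtain ⟨z, rfl⟩ := IsLocalRing.residue_surjective x
    show τ0 (τ0 (resF z)) = resF z
    rw [hτ0, hτ0, hτ]
  have hFc : CharZero F := by
    have := (resF.comp q).injective
    exact charZero_of_injective_ringHom this
  have hnil : IsNilpotent (RingHom.ker (resK.toRatAlgHom : Z0 →ₐ[ℚ] K)) := by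
    have hn : IsNilpotent (IsLocalRing.maximalIdeal Z) :=
      (IsLocalRing.jacobson_eq_maximalIdeal (⊥ : Ideal Z) bot_ne_top) ▸
        IsArtinianRing.isNilpotent_jacobson_bot
    obtain ⟨N, hN⟩ := hn
    refine ⟨N, ?_⟩
    have h1 : RingHom.ker (resK.toRatAlgHom : Z0 →ₐ[ℚ] K) ≤
        (IsLocalRing.maximalIdeal Z).comap Z0.subtype := by
      intro z hz
      have hz : resK z = 0 := hz
      rw [Ideal.mem_comap, ← IsLocalRing.residue_eq_zero_iff]
      show resF z = 0
      rw [← hf, hz, map_zero]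
    have h2 := (Ideal.pow_right_mono h1 N).trans (Ideal.le_comap_pow _ N)
    rw [hN] at h2
    refine le_bot_iff.1 (h2.trans ?_)
    intro z hz
    have : (z : Z) = 0 := hz
    exact (Submodule.mem_bot _).2 (Subtype.ext this)
  have hsm : Algebra.FormallySmooth ℚ K := by
    obtain ⟨S, hS⟩ := exists_isTranscendenceBasis ℚ K
    have := hS.isAlgebraic_field
    exact Algebra.FormallySmooth.of_algebraicIndependent_of_isSeparable hS.1
  let s0 : K →ₐ[ℚ] Z0 := Algebra.FormallySmooth.liftOfSurjective (AlgHom.id ℚ K)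
    (resK.toRatAlgHom : Z0 →ₐ[ℚ] K) IsLocalRing.residue_surjective hnil
  have hs0 : ∀ k, resK (s0 k) = k := fun k =>
    Algebra.FormallySmooth.liftOfSurjective_apply (AlgHom.id ℚ K)
      (resK.toRatAlgHom : Z0 →ₐ[ℚ] K) IsLocalRing.residue_surjective hnil k
  let s : K →+* Z := Z0.subtype.comp s0.toRingHom
  have hs : ∀ k, resF (s k) = f k := fun k => by
    show resF (s0 k : Z) = f k
    rw [← hf, hs0]
  have hfix : ∀ x, τ0 x = x ↔ ∃ y, f y = x := by
    intro x
    constructor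
    · intro hx
      obtain ⟨z, rfl⟩ := IsLocalRing.residue_surjective x
      let h0 : Z0 := q0 (1/2)
      have hz : τ (h0 * (z + τ z)) = h0 * (z + τ z) := by
        rw [map_mul, map_add, hτ, add_comm, (hZ0 _).1 h0.2]
      have h02 : (h0 : Z) * 2 = 1 := by
        have : h0 * 2 = 1 := by
          have : q0 (1/2) * q0 2 = 1 := by rw [← map_mul]; norm_num
          rwa [map_ofNat] at this
        exact congrArg Z0.subtype this
      refine ⟨resK ⟨_, (hZ0 _).2 hz⟩, ?_⟩
      rw [hf]
      show resF (h0 * (z + τ z)) = resF z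
      rw [map_mul, map_add, ← hτ0]
      rw [show τ0 (resF z) = resF z from hx, ← two_mul, ← mul_assoc]
      have := congrArg resF h02
      rw [map_mul, map_ofNat, map_one] at this
      rw [this, one_mul]
    · rintro ⟨y, rfl⟩
      rw [← hs, hτ0]
      exact congrArg resF ((hZ0 _).1 (s0 y).2)
  have hmem : ∀ z w : Z, resF z = resF w → z - w ∈ IsLocalRing.maximalIdeal Z := by
    intro z w h
    rw [← IsLocalRing.residue_eq_zero_iff, map_sub]
    exact sub_eq_zero.2 h
  refine ⟨K, inferInstance, s, hKc, ?_, fun k => (hZ0 _).1 (s0 k).2, ?_⟩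
  · have : FiniteDimensional ℝ F :=
      Module.Finite.of_surjective (IsScalarTower.toAlgHom ℝ Z F).toLinearMap
        IsLocalRing.residue_surjective
    rcases Real.nonempty_algEquiv_or F with ⟨⟨e⟩⟩ | ⟨⟨e⟩⟩
    · have hid : ∀ x, τ0 x = x := by
        intro x
        have := RingHom.congr_fun (Subsingleton.elim
          ((e.toRingEquiv.toRingHom.comp τ0).comp e.symm.toRingEquiv.toRingHom) (RingHom.id ℝ)) (e x)
        have : e (τ0 (e.symm (e x))) = e x := this
        rw [e.symm_apply_apply] at this
        exact e.injective this
      refine goodField_of_involution K ℂ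
        (Complex.ofRealHom.comp (e.toRingEquiv.toRingHom.comp f)) (starRingEnd ℂ) (by simp) ?_
      intro x
      rw [Complex.conj_eq_iff_real]
      constructor
      · rintro ⟨r, rfl⟩
        obtain ⟨y, hy⟩ := (hfix (e.symm r)).1 (hid _)
        refine ⟨y, ?_⟩
        show ((e (f y) : ℝ) : ℂ) = r
        rw [hy, e.apply_symm_apply]
      · rintro ⟨y, rfl⟩
        exact ⟨_, rfl⟩
    · have : IsAlgClosed F := IsAlgClosed.of_ringEquiv ℂ F e.symm.toRingEquiv
      exact goodField_of_involution K F f τ0 hτ00 hfix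
  · by_cases hid : ∀ x, τ0 x = x
    · refine ⟨0, fun z => ?_⟩
      obtain ⟨y, hy⟩ := (hfix (resF z)).1 (hid _)
      refine ⟨y, 0, hmem _ _ ?_⟩
      rw [mul_zero, add_zero, hs, hy]
    · push Not at hid
      obtain ⟨y, hy⟩ := hid
      obtain ⟨t, ht⟩ := IsLocalRing.residue_surjective (y - τ0 y)
      have ht : resF t = y - τ0 y := ht
      have hd : y - τ0 y ≠ 0 := fun h => hy (sub_eq_zero.1 h).symm
      refine ⟨t, fun z => ?_⟩
      set x := resF z with hx
      obtain ⟨u, hu⟩ := (hfix ((x + τ0 x) / 2)).1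
        (by rw [map_div₀, map_add, hτ00, map_ofNat, add_comm])
      obtain ⟨v, hv⟩ := (hfix ((x - τ0 x) / (2 * (y - τ0 y)))).1 (by
        simp only [map_div₀, map_sub, map_mul, hτ00, map_ofNat]
        rw [← neg_sub x, ← neg_sub y]
        rw [mul_neg, neg_div_neg_eq])
      refine ⟨u, v, hmem _ _ ?_⟩
      rw [map_add, map_mul, hs, hs, ht, hu, hv, ← hx]
      field_simp
      ring

theorem finite_of_isFiniteLength (K Z : Type) [Field K] [CommRing Z] [IsLocalRing Z] [Algebra K Z]
    (t : Z) (ht : ∀ z, ∃ k₁ k₂ : K,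
      z - (algebraMap K Z k₁ + algebraMap K Z k₂ * t) ∈ IsLocalRing.maximalIdeal Z)
    (M : Type) [AddCommGroup M] [Module Z M] (hM : IsFiniteLength Z M) :
    ∀ [Module K M] [IsScalarTower K Z M], Module.Finite K M := by
  classical
  induction hM with
  | of_subsingleton => intros; infer_instance
  | @of_simple_quotient M _ _ N hsimp _ ih =>
    intro _ _
    have h1 : Module.Finite K N := ih
    have h2 : Module.Finite K (M ⧸ N) := by
      have : Nontrivial (M ⧸ N) := IsSimpleModule.nontrivial Z _
      obtain ⟨x, hx⟩ := exists_ne (0 : M ⧸ N)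
      have kill : ∀ r ∈ IsLocalRing.maximalIdeal Z, r • x = 0 := by
        intro r hr
        by_contra hne
        obtain ⟨c, hc⟩ := IsSimpleModule.toSpanSingleton_surjective Z hne x
        have hc : c • r • x = x := hc
        have hu : IsUnit (1 - c * r) := by
          refine (IsLocalRing.isUnit_or_isUnit_one_sub_self (c * r)).resolve_left fun h => ?_
          exact (IsLocalRing.mem_maximalIdeal r).1 hr (isUnit_of_mul_isUnit_right h)
        have : (1 - c * r) • x = 0 := by rw [sub_smul, one_smul, mul_smul, hc, sub_self]
        exact hx ((hu.smul_eq_zero).1 this)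
      refine ⟨⟨{x, t • x}, ?_⟩⟩
      rw [eq_top_iff]
      rintro y -
      obtain ⟨z, hz⟩ := IsSimpleModule.toSpanSingleton_surjective Z hx y
      have hz : z • x = y := hz
      obtain ⟨k₁, k₂, hk⟩ := ht z
      have h := kill _ hk
      rw [sub_smul, sub_eq_zero, hz, add_smul, mul_smul, algebraMap_smul, algebraMap_smul] at h
      rw [h]
      exact add_mem (Submodule.smul_mem _ _ (Submodule.subset_span (by simp)))
        (Submodule.smul_mem _ _ (Submodule.subset_span (by simp)))
    have h3 : Module.Finite K (N.restrictScalars K) := h1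
    have h4 : Module.Finite K (M ⧸ N.restrictScalars K) :=
      Module.Finite.equiv (Submodule.Quotient.restrictScalarsEquiv K N).symm
    exact Module.Finite.of_submodule_quotient (N.restrictScalars K)

theorem exists_good_structure (R : Type) [Ring R] [Algebra ℝ R]
    [StarRing R] [FiniteDimensional ℝ R] [IsLocalRing R] :
    ∃ (K : Type) (_ : Field K) (_ : Algebra K R), CharZero K ∧ GoodField K ∧
      FiniteDimensional K R ∧ ∀ (k : K) (x : R), star (k • x) = k • star x := by
  let Z := Subalgebra.center ℝ R
  have hZ : ∀ z : R, z ∈ Z ↔ ∀ x, x * z = z * x := fun z => Subalgebra.mem_center_iff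
  have hunit : ∀ z : Z, IsUnit (z : R) → IsUnit z := by
    rintro ⟨z, hz⟩ ⟨u, hu⟩
    have hu' : (u : R) = z := hu
    have hc : (↑u⁻¹ : R) ∈ Z := by
      rw [hZ]
      intro x
      have h : Commute x (u : R) := by rw [hu']; exact (hZ z).1 hz x
      exact h.units_inv_right
    exact IsUnit.of_mul_eq_one ⟨_, hc⟩ (Subtype.ext (by
      show z * (↑u⁻¹ : R) = 1
      rw [← hu', Units.mul_inv]))
  have : IsLocalRing Z := IsLocalRing.of_isUnit_or_isUnit_one_sub_self fun a => by
    rcases IsLocalRing.isUnit_or_isUnit_of_add_one (add_sub_cancel (a : R) 1) with h | h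
    · exact Or.inl (hunit _ h)
    · exact Or.inr (hunit _ (by simpa using h))
  have hstar : ∀ z : Z, star (z : R) ∈ Z := by
    rintro ⟨z, hz⟩
    rw [hZ] at hz ⊢
    intro x
    have := congrArg star (hz (star x))
    simpa using this.symm
  let τ : Z →+* Z :=
    { toFun := fun z => ⟨star (z : R), hstar z⟩
      map_one' := Subtype.ext (star_one R)
      map_zero' := Subtype.ext (star_zero R)
      map_add' := fun a b => Subtype.ext (star_add _ _)
      map_mul' := fun a b => by
        rw [mul_comm a b]
        exact Subtype.ext (star_mul _ _) }
  obtain ⟨K, _, s, hc, hg, hfix, t, ht⟩ := coeff_field Z τ (fun x => Subtype.ext (star_star _))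
  let _ : Algebra K Z := s.toAlgebra
  let _ : Algebra K R := (Z.val.toRingHom.comp s).toAlgebra' (fun k x => ((hZ _).1 (s k).2 x).symm)
  have : IsScalarTower K Z R := ⟨fun k z x => mul_assoc (s k : R) (z : R) x⟩
  refine ⟨K, inferInstance, inferInstance, hc, hg, ?_, ?_⟩
  · have : IsArtinian Z R := isArtinian_of_tower ℝ inferInstance
    have : IsNoetherian Z R := isNoetherian_of_tower ℝ inferInstance
    exact finite_of_isFiniteLength K Z t ht R (isFiniteLength_iff_isNoetherian_isArtinian.2 ⟨‹_›, ‹_›⟩)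
  · intro k x
    have hk : star (s k : R) = s k := congrArg Subtype.val (hfix k)
    rw [Algebra.smul_def, Algebra.smul_def, star_mul]
    show star x * star (s k : R) = (s k : R) * star x
    rw [hk, (hZ _).1 (s k).2]
theorem core_comm (K B : Type) [Field K] [CharZero K] (hK : GoodField K) [CommRing B] [Nontrivial B]
    [Algebra K B] [FiniteDimensional K B] (hconn : ∀ e : B, e * e = e → e = 0 ∨ e = 1) (a : B) :
    (∃ l : K, IsNilpotent (a - algebraMap K B l) ∧ (l = 0 ∨ ¬ ∃ y, y * y = l)) ∨
    (∃ b b' c' : B, b * b = a ∧ b * b' = 1 ∧ (1 - b) * c' = 1) := by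
  have : IsArtinianRing B := IsArtinianRing.of_finite K B
  have un : ∀ r : B, IsUnit r ∨ IsNilpotent r := by
    intro r
    obtain ⟨n, y, hy⟩ := IsArtinian.exists_pow_succ_smul_dvd r (1 : B)
    simp only [smul_eq_mul, mul_one] at hy
    have h1 : ∀ m, r ^ n * (r * y) ^ m = r ^ n := by
      intro m
      induction m with
      | zero => simp
      | succ m ih =>
        rw [pow_succ, ← mul_assoc, ih]
        calc r ^ n * (r * y) = r ^ (n + 1) * y := by ring
          _ = _ := hy
    have h2 : r ^ n * (r ^ n * y ^ n) = r ^ n := by rw [← mul_pow]; exact h1 n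
    rcases hconn (r ^ n * y ^ n) (by
      calc r ^ n * y ^ n * (r ^ n * y ^ n) = r ^ n * (r ^ n * y ^ n) * y ^ n := by ring
        _ = _ := by rw [h2]) with h | h
    · right; exact ⟨n, by rw [← h2, h, mul_zero]⟩
    · left
      have hu : IsUnit (r ^ n) := IsUnit.of_mul_eq_one _ h
      refine IsUnit.of_mul_eq_one y (hu.mul_left_cancel ?_)
      simpa using h1 1
  have : IsLocalRing B := IsLocalRing.of_isUnit_or_isUnit_one_sub_self fun r =>
    (un r).imp id fun h => h.isUnit_one_sub
  have nilm : ∀ r : B, IsLocalRing.residue B r = 0 → IsNilpotent r := by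
    intro r hr
    rw [IsLocalRing.residue_eq_zero_iff] at hr
    exact (un r).resolve_left ((IsLocalRing.mem_maximalIdeal r).1 hr)
  have : FiniteDimensional K (IsLocalRing.ResidueField B) :=
    Module.Finite.of_surjective (IsScalarTower.toAlgHom K B (IsLocalRing.ResidueField B)).toLinearMap
      IsLocalRing.residue_surjective
  have halg : ∀ l : K, algebraMap K (IsLocalRing.ResidueField B) l =
    IsLocalRing.residue B (algebraMap K B l) := fun l =>
      IsScalarTower.algebraMap_apply K B (IsLocalRing.ResidueField B) l
  by_cases hne : ∃ l : K, IsNilpotent (a - algebraMap K B l) ∧ (l = 0 ∨ ¬ ∃ y, y * y = l)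
  · exact Or.inl hne
  right
  have hy : ∃ y, IsNilpotent (a - y * y) := by
    rcases hK.1 (IsLocalRing.ResidueField B) with h | h
    · obtain ⟨l, hl⟩ := h (IsLocalRing.residue B a)
      have hn : IsNilpotent (a - algebraMap K B l) := nilm _ (by rw [map_sub, ← halg, hl, sub_self])
      push Not at hne
      obtain ⟨_, y, hy⟩ := hne l hn
      exact ⟨algebraMap K B y, by rw [← map_mul, hy]; exact hn⟩
    · obtain ⟨y, hy⟩ := h (IsLocalRing.residue B a)
      obtain ⟨y, rfl⟩ := IsLocalRing.residue_surjective y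
      exact ⟨y, nilm _ (by rw [map_sub, map_mul, hy, sub_self])⟩
  have hau : IsUnit a := (un a).resolve_right fun h => hne ⟨0, by simpa using h, Or.inl rfl⟩
  obtain ⟨y, hy⟩ := hy
  have h2u : IsUnit (2 : B) := by
    have : IsUnit (algebraMap K B 2) := (isUnit_iff_ne_zero.2 two_ne_zero).map _
    rwa [map_ofNat] at this
  have hyu : IsUnit y := by
    refine (un y).resolve_right fun h => ?_
    have : IsNilpotent a := by
      have := (Commute.all _ _).isNilpotent_add hy ((Commute.all y y).isNilpotent_mul_left h)
      simpa using this
    exact hau.not_isNilpotent this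
  obtain ⟨b, ⟨hb1, hb2⟩, -⟩ := Polynomial.existsUnique_nilpotent_sub_and_aeval_eq_zero
    (P := (Polynomial.X ^ 2 - Polynomial.C a : Polynomial B)) (x := y)
    (by
      have := hy.neg
      simpa [sq] using this)
    (by simpa [Polynomial.derivative_X_pow, one_add_one_eq_two] using h2u.mul hyu)
  have hbb : b * b = a := by
    have : b ^ 2 - a = 0 := by simpa using hb2
    rw [← sq]; exact sub_eq_zero.1 this
  have hbu : IsUnit b := isUnit_of_mul_isUnit_left (hbb ▸ hau)
  have hor : IsUnit (1 - b) ∨ IsUnit (1 + b) :=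
    IsLocalRing.isUnit_or_isUnit_of_isUnit_add (by convert h2u using 1; ring)
  obtain ⟨b', hb'⟩ := hbu.exists_right_inv
  rcases hor with h | h
  · obtain ⟨c, hc⟩ := h.exists_right_inv
    exact ⟨b, b', c, hbb, hb', hc⟩
  · obtain ⟨c, hc⟩ := h.exists_right_inv
    exact ⟨-b, -b', c, by rw [neg_mul_neg, hbb], by rw [neg_mul_neg, hb'],
      by rw [sub_neg_eq_add, hc]⟩

theorem commute_aeval (K A : Type) [Field K] [Ring A] [Algebra K A] (x a : A) (h : Commute x a)
    (p : Polynomial K) : Commute x (Polynomial.aeval a p) := by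
  rw [Polynomial.aeval_eq_sum_range]
  exact Commute.sum_right _ _ _ fun i _ => (h.pow_right i).smul_right _

theorem corner_lemma (K A : Type) [Field K] [CharZero K] (hK : GoodField K) [Ring A] [Algebra K A]
    [FiniteDimensional K A] (P a : A) (hP : P * P = P) (hP0 : P ≠ 0) (haP : a * P = a)
    (hPa : P * a = a) (φ : Polynomial K →ₗ[K] A) (hφ : ∀ p, φ p = Polynomial.aeval a p * P)
    (hconn : ∀ p, φ p * φ p = φ p → φ p = 0 ∨ φ p = P) :
    (∃ l : K, IsNilpotent (a - l • P) ∧ (l = 0 ∨ ¬ ∃ y, y * y = l)) ∨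
    (∃ b b' c' : Polynomial K, φ b * φ b = a ∧ φ b * φ b' = P ∧ (P - φ b) * φ c' = P) := by
  have hcomm : ∀ p, Commute P (Polynomial.aeval a p) :=
    commute_aeval K A P a (by rw [Commute, SemiconjBy, haP, hPa])
  have hmul : ∀ p q, φ (p * q) = φ p * φ q := by
    intro p q
    rw [hφ, hφ, hφ, map_mul]
    calc _ = Polynomial.aeval a p * (Polynomial.aeval a q * (P * P)) := by rw [hP, mul_assoc]
      _ = Polynomial.aeval a p * (P * Polynomial.aeval a q * P) := by
        rw [(hcomm q).eq, mul_assoc]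
      _ = _ := by simp only [mul_assoc]
  have hone : φ 1 = P := by rw [hφ, map_one, one_mul]
  have hX : φ Polynomial.X = a := by rw [hφ, Polynomial.aeval_X, haP]
  let I : Ideal (Polynomial K) :=
    { carrier := {p | φ p = 0}
      add_mem' := fun {p q} hp hq => by
        have hp : φ p = 0 := hp
        have hq : φ q = 0 := hq
        show φ (p + q) = 0
        rw [map_add, hp, hq, add_zero]
      zero_mem' := map_zero φ
      smul_mem' := fun c p hp => by
        have hp : φ p = 0 := hp
        show φ (c * p) = 0
        rw [hmul, hp, mul_zero] }
  have hI : ∀ p, p ∈ I ↔ φ p = 0 := fun p => Iff.rfl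
  let B := Polynomial K ⧸ I
  let mk : Polynomial K →+* B := Ideal.Quotient.mk I
  have hmk : ∀ p q, mk p = mk q ↔ φ p = φ q := by
    intro p q
    rw [show mk p = mk q ↔ p - q ∈ I from Ideal.Quotient.eq, hI, map_sub, sub_eq_zero]
  have hsurj : Function.Surjective mk := Ideal.Quotient.mk_surjective
  have : Nontrivial B := ⟨mk 1, mk 0, fun h => hP0 (by
    rw [hmk, hone, map_zero] at h; exact h)⟩
  have : FiniteDimensional K B := by
    have hinj : Function.Injective ((I.restrictScalars K).liftQ φ (fun p hp => hp)) := by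
      rw [← LinearMap.ker_eq_bot]
      exact Submodule.ker_liftQ_eq_bot _ _ _ (fun p hp => hp)
    have : FiniteDimensional K (Polynomial K ⧸ I.restrictScalars K) := Module.Finite.of_injective _ hinj
    exact Module.Finite.equiv (Submodule.Quotient.restrictScalarsEquiv K I)
  have halg : ∀ l : K, algebraMap K B l = mk (l • 1) := by
    intro l
    rw [← Polynomial.C_mul', mul_one]
    rfl
  have hc : ∀ e : B, e * e = e → e = 0 ∨ e = 1 := by
    intro e he
    obtain ⟨p, rfl⟩ := hsurj e
    rw [← map_mul, hmk, hmul] at he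
    rcases hconn p he with h | h
    · left; rw [← map_zero mk, hmk, h, map_zero]
    · right; rw [← map_one mk, hmk, h, hone]
  rcases core_comm K B hK hc (mk Polynomial.X) with ⟨l, ⟨n, hn⟩, hl⟩ | ⟨b, b', c', h1, h2, h3⟩
  · left
    refine ⟨l, ⟨n + 1, ?_⟩, hl⟩
    have hpow : ∀ (p : Polynomial K) m, φ (p ^ (m + 1)) = φ p ^ (m + 1) := by
      intro p m
      induction m with
      | zero => simp
      | succ m ih => rw [pow_succ, hmul, ih, ← pow_succ]
    have h : mk ((Polynomial.X - l • 1) ^ (n + 1)) = mk 0 := by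
      rw [map_pow, map_sub, ← halg, pow_succ, hn, zero_mul, map_zero]
    rw [hmk, hpow, map_sub, map_smul, hX, hone, map_zero] at h
    exact h
  · right
    obtain ⟨b, rfl⟩ := hsurj b
    obtain ⟨b', rfl⟩ := hsurj b'
    obtain ⟨c', rfl⟩ := hsurj c'
    rw [← map_mul, hmk, hmul, hX] at h1
    rw [← map_mul, ← map_one mk, hmk, hmul, hone] at h2
    rw [← map_one mk, ← map_sub, ← map_mul, hmk, hmul, map_sub, hone] at h3
    exact ⟨b, b', c', h1, h2, h3⟩

/-- Nonzero self-adjoint idempotents commuting with `H` that cannot be split further. -/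
def PrimProj {A : Type} [Ring A] [StarRing A] (H P : A) : Prop :=
  P * P = P ∧ star P = P ∧ Commute P H ∧ P ≠ 0 ∧
    ∀ e : A, e * e = e → star e = e → Commute e H → e * P = e → e = 0 ∨ e = P

theorem reflection_lemma {A : Type} [Ring A] [StarRing A] (H P Q b b' c' : A)
    (hH : star H = H)
    (hP : PrimProj H P) (hQ : PrimProj H Q)
    (hbs : star b = b) (hbs' : star b' = b') (hcs' : star c' = c')
    (hbH : Commute b H) (hbH' : Commute b' H) (hcH' : Commute c' H)
    (hbP : b * P = b) (hPb : P * b = b) (hbP' : b' * P = b') (hPb' : P * b' = b')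
    (hcP' : c' * P = c') (hPc' : P * c' = c')
    (hb : b * b = P * Q * P) (hbb' : b * b' = P) (hbb2 : b' * b = P) (hc : (P - b) * c' = P)
    (hc2 : c' * (P - b) = P) :
    ∃ r : A, star r = r ∧ r * r = 1 ∧ Commute r H ∧ r * Q * r = P ∧
      ∀ x, x * P = 0 → x * Q = 0 → x * r = x := by
  obtain ⟨hPP, hPs, hPH, hP0, -⟩ := hP
  obtain ⟨hQQ, hQs, hQH, hQ0, hQprim⟩ := hQ
  have hvP : b' * Q * P = b := by
    calc b' * Q * P = b' * P * Q * P := by rw [hbP']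
      _ = b' * (P * Q * P) := by simp only [mul_assoc]
      _ = b' * b * b := by rw [← hb, mul_assoc]
      _ = b := by rw [hbb2, hPb]
  have hPv : P * Q * b' = b := by
    have := congrArg star hvP
    simpa [hbs, hbs', hPs, hQs, mul_assoc] using this
  have hvv : b' * Q * (Q * b') = P := by
    calc b' * Q * (Q * b') = b' * (Q * Q) * b' := by simp only [mul_assoc]
      _ = b' * Q * (P * b') := by rw [hQQ, hPb']
      _ = (b' * Q * P) * b' := by simp only [mul_assoc]
      _ = P := by rw [hvP, hbb']
  have hev : Q * b' * (b' * Q) = Q := by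
    refine (hQprim (Q * b' * (b' * Q)) ?_ ?_ ?_ ?_).resolve_left ?_
    · calc Q * b' * (b' * Q) * (Q * b' * (b' * Q))
          = Q * b' * (b' * Q * (Q * b')) * (b' * Q) := by simp only [mul_assoc]
        _ = Q * (b' * P) * (b' * Q) := by rw [hvv]; simp only [mul_assoc]
        _ = _ := by rw [hbP']
    · simp [hbs', hQs, mul_assoc]
    · exact (hQH.mul_left hbH').mul_left (hbH'.mul_left hQH)
    · simp only [mul_assoc, hQQ]
    · intro h0
      apply hP0
      calc P = P * P := hPP.symm
        _ = b' * Q * (Q * b') * (b' * Q * (Q * b')) := by rw [hvv]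
        _ = b' * Q * (Q * b' * (b' * Q)) * (Q * b') := by simp only [mul_assoc]
        _ = 0 := by rw [h0]; simp
  have hws : star (P - Q * b') = P - b' * Q := by simp [hPs, hbs', hQs]
  have hww : (P - b' * Q) * (P - Q * b') = (P - b) + (P - b) := by
    have e1 : P * (Q * b') = b := by rw [← mul_assoc, hPv]
    rw [sub_mul, mul_sub, mul_sub, hPP, hvv, e1, hvP]
    abel
  have hwP : (P - b' * Q) * P = P - b := by rw [sub_mul, hPP, hvP]
  have hwc : (P - Q * b') * P = P - Q * b' := by rw [sub_mul, hPP, mul_assoc, hbP']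
  set w := P - Q * b' with hw
  set w' := P - b' * Q with hw'
  have hws' : star w' = w := by rw [← hws, star_star]
  set r := 1 - w * c' * w' with hr
  have hrs : star r = r := by
    rw [hr]; simp [hws, hws', hcs', mul_assoc]
  have hrr : r * r = 1 := by
    have : w * c' * w' * (w * c' * w') = w * c' * w' + w * c' * w' := by
      calc w * c' * w' * (w * c' * w') = w * c' * (w' * w) * (c' * w') := by simp only [mul_assoc]
        _ = w * (c' * (P - b)) * (c' * w') + w * (c' * (P - b)) * (c' * w') := by
          rw [hww, mul_add, add_mul]; simp only [mul_assoc]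
        _ = _ := by rw [hc2, hwc]; simp only [mul_assoc]
    have key : ∀ y : A, y * y = y + y → (1 - y) * (1 - y) = 1 := by
      intro y hy
      rw [sub_mul, mul_sub, mul_sub, hy]
      simp
    exact key _ this
  have hrP : r * P = Q * b' := by
    calc r * P = P - w * c' * (w' * P) := by rw [hr, sub_mul, one_mul]; simp only [mul_assoc]
      _ = P - w * (c' * (P - b)) := by rw [hwP, mul_assoc]
      _ = P - w := by rw [hc2, hwc]
      _ = Q * b' := by rw [hw]; abel
  have hPr : P * r = b' * Q := by
    have := congrArg star hrP
    simpa [hrs, hPs, hQs, hbs'] using this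
  refine ⟨r, hrs, hrr, ?_, ?_, ?_⟩
  · have h1 : Commute w H := hPH.sub_left (hQH.mul_left hbH')
    have h2 : Commute w' H := hPH.sub_left (hbH'.mul_left hQH)
    exact (Commute.one_left H).sub_left ((h1.mul_left hcH').mul_left h2)
  · have h : r * P * (P * r) = Q := by rw [hrP, hPr, hev]
    rw [← h]
    calc r * (r * P * (P * r)) * r = (r * r) * (P * P) * (r * r) := by simp only [mul_assoc]
      _ = P := by rw [hrr, hPP]; simp
  · intro x hxP hxQ
    have : x * w = 0 := by rw [hw, mul_sub, hxP, ← mul_assoc, hxQ]; simp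
    rw [hr, mul_sub, mul_one, ← mul_assoc, ← mul_assoc, this]; simp

theorem step_lemma (K A : Type) [Field K] [CharZero K] (hK : GoodField K) [Ring A] [StarRing A]
    [Algebra K A] [FiniteDimensional K A] (hst : ∀ (k : K) (x : A), star (k • x) = k • star x)
    (H P : A) (hH : star H = H) (hP : PrimProj H P) (k : ℕ) (Q : Fin k → A)
    (hQ : ∀ j, PrimProj H (Q j)) (hsum : ∑ j, Q j = 1) :
    ∃ (j : Fin k) (r : A), P * Q j ≠ 0 ∧ star r = r ∧ r * r = 1 ∧ Commute r H ∧ r * Q j * r = P ∧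
      ∀ x, x * P = 0 → x * Q j = 0 → x * r = x := by
  have hP' := hP
  obtain ⟨hPP, hPs, hPH, hP0, hprim⟩ := hP
  let a : Fin k → A := fun j => P * Q j * P
  have haP : ∀ j, a j * P = a j := fun j => by simp only [a, mul_assoc, hPP]
  have hPa : ∀ j, P * a j = a j := fun j => by simp only [a, ← mul_assoc, hPP]
  have has : ∀ j, star (a j) = a j := fun j => by
    simp [a, hPs, (hQ j).2.1, mul_assoc]
  have haH : ∀ j, Commute (a j) H := fun j => (hPH.mul_left (hQ j).2.2.1).mul_left hPH
  let φ : Fin k → Polynomial K →ₗ[K] A := fun j =>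
    (LinearMap.mulRight K P).comp (Polynomial.aeval (a j)).toLinearMap
  have hφ : ∀ j p, φ j p = Polynomial.aeval (a j) p * P := fun j p => rfl
  have hcP : ∀ j p, Commute P (Polynomial.aeval (a j) p) := fun j p =>
    commute_aeval K A P (a j) (by rw [Commute, SemiconjBy, haP, hPa]) p
  have hφP : ∀ j p, φ j p * P = φ j p := fun j p => by rw [hφ, mul_assoc, hPP]
  have hPφ : ∀ j p, P * φ j p = φ j p := fun j p => by
    rw [hφ, ← mul_assoc, (hcP j p).eq, mul_assoc, hPP]
  have hφs : ∀ j p, star (φ j p) = φ j p := fun j p => by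
    have : star (Polynomial.aeval (a j) p) = Polynomial.aeval (a j) p := by
      rw [Polynomial.aeval_eq_sum_range, star_sum]
      exact Finset.sum_congr rfl fun i _ => by rw [hst, star_pow, has]
    rw [hφ, star_mul, this, hPs, (hcP j p).eq]
  have hφH : ∀ j p, Commute (φ j p) H := fun j p =>
    ((commute_aeval K A H (a j) (haH j).symm p).symm).mul_left hPH
  have hφc : ∀ j p q, Commute (φ j p) (φ j q) := fun j p q => by
    have h1 : Commute (Polynomial.aeval (a j) p) (Polynomial.aeval (a j) q) := by
      rw [Commute, SemiconjBy, ← map_mul, mul_comm, map_mul]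
    exact (h1.mul_right (hcP j p).symm).mul_left ((hcP j q).mul_right (Commute.refl P))
  have hcor := fun j => corner_lemma K A hK P (a j) hPP hP0 (haP j) (hPa j) (φ j) (hφ j)
    (fun p hp => hprim _ hp (hφs j p) (hφH j p) (hφP j p))
  have hex : ∃ j, ∃ b b' c' : Polynomial K, φ j b * φ j b = a j ∧ φ j b * φ j b' = P ∧
      (P - φ j b) * φ j c' = P := by
    by_contra hno
    have hl : ∀ j, ∃ l : K, IsNilpotent (a j - l • P) ∧ (l = 0 ∨ ¬ ∃ y, y * y = l) :=
      fun j => (hcor j).resolve_right fun h => hno ⟨j, h⟩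
    choose l hl1 hl2 using hl
    let tr : A →ₗ[K] K := (LinearMap.trace K A).comp (Algebra.lmul K A).toLinearMap
    have htr : ∀ x, tr x = LinearMap.trace K A (Algebra.lmul K A x) := fun x => rfl
    have htP : tr P ≠ 0 := by
      rw [htr]
      intro h0
      have hid : IsIdempotentElem (Algebra.lmul K A P) := by
        rw [IsIdempotentElem, ← map_mul, hPP]
      have := (LinearMap.IsIdempotentElem.trace_eq_zero_iff hid).1 h0
      have := congrArg (fun f => f 1) this
      exact hP0 (by simpa using this)
    have hta : ∀ j, tr (a j) = l j * tr P := by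
      intro j
      have : tr (a j - l j • P) = 0 := by
        rw [htr]
        exact (LinearMap.isNilpotent_trace_of_isNilpotent ((hl1 j).map (Algebra.lmul K A))).eq_zero
      rw [map_sub, map_smul, sub_eq_zero] at this
      exact this
    have hsa : ∑ j, a j = P := by
      simp only [a]
      rw [← Finset.sum_mul, ← Finset.mul_sum, hsum, mul_one, hPP]
    have h1 : ∑ j, l j = 1 := by
      apply mul_right_cancel₀ htP
      rw [Finset.sum_mul, one_mul]
      conv_rhs => rw [← hsa]
      rw [map_sum]
      exact Finset.sum_congr rfl fun j _ => (hta j).symm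
    obtain ⟨j, hj0, hj⟩ := hK.2 k l h1
    rcases hl2 j with h | h
    · exact hj0 h
    · exact h hj
  obtain ⟨j, b, b', c', h1, h2, h3⟩ := hex
  obtain ⟨r, hr⟩ := reflection_lemma H P (Q j) (φ j b) (φ j b') (φ j c') hH hP' (hQ j)
    (hφs _ _) (hφs _ _) (hφs _ _) (hφH _ _) (hφH _ _) (hφH _ _) (hφP _ _) (hPφ _ _) (hφP _ _)
    (hPφ _ _) (hφP _ _) (hPφ _ _) h1 h2 (by rw [(hφc j b' b).eq, h2]) h3
    (by rw [mul_sub, hφP, (hφc j c' b).eq, ← h3, sub_mul, hPφ])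
  refine ⟨j, r, ?_, hr⟩
  intro h0
  apply hP0
  have ha0 : a j = 0 := by simp only [a, h0, zero_mul]
  calc P = P * P := hPP.symm
    _ = φ j b * φ j b' * (φ j b * φ j b') := by rw [h2]
    _ = φ j b * φ j b * (φ j b' * φ j b') := by
      rw [mul_assoc, ← mul_assoc (φ j b'), (hφc j b' b).eq]; simp only [mul_assoc]
    _ = 0 := by rw [h1, ha0, zero_mul]

theorem max_lemma {A : Type} [Ring A] [StarRing A] (H : A) (k : ℕ) (P : Fin k → A)
    (hPsa : ∀ i, star (P i) = P i)
    (hPorth : ∀ i j, P i * P j = if i = j then P i else 0)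
    (hPne : ∀ i, P i ≠ 0)
    (hPsum : H = ∑ i, P i * H * P i)
    (hmax : ∀ (k' : ℕ) (P' : Fin k' → A),
        (∀ i, star (P' i) = P' i) →
        (∀ i j, P' i * P' j = if i = j then P' i else 0) →
        (∀ i, P' i ≠ 0) →
        H = ∑ i, P' i * H * P' i → k' ≤ k) :
    (∀ i, PrimProj H (P i)) ∧ ∑ i, P i = 1 := by
  classical
  have hPP : ∀ i, P i * P i = P i := fun i => by rw [hPorth, if_pos rfl]
  have hPz : ∀ i j, i ≠ j → P i * P j = 0 := fun i j h => by rw [hPorth, if_neg h]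
  have hPH : ∀ i, Commute (P i) H := by
    intro i
    have h1 : P i * H = P i * H * P i := by
      conv_lhs => rw [hPsum]
      rw [Finset.mul_sum, Finset.sum_eq_single i]
      · rw [← mul_assoc, ← mul_assoc, hPP]
      · intro j _ hj
        rw [← mul_assoc, ← mul_assoc, hPz i j hj.symm, zero_mul, zero_mul]
      · simp
    have h2 : H * P i = P i * H * P i := by
      conv_lhs => rw [hPsum]
      rw [Finset.sum_mul, Finset.sum_eq_single i]
      · rw [mul_assoc, hPP]
      · intro j _ hj
        rw [mul_assoc, hPz j i hj, mul_zero]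
      · simp
    exact h1.trans h2.symm
  have hbig : ∀ (P' : Fin (k + 1) → A), (∀ i, star (P' i) = P' i) → (∀ i, P' i * P' i = P' i) →
      (∀ i j, i ≠ j → P' i * P' j = 0) → (∀ i, P' i ≠ 0) → (∀ i, Commute (P' i) H) →
      ∑ i, P' i = 1 → False := by
    intro P' h1 h2 h3 h4 h5 h6
    have := hmax (k + 1) P' h1 (fun i j => by
      by_cases h : i = j
      · subst h; rw [if_pos rfl, h2]
      · rw [if_neg h, h3 i j h]) h4 (by
        have : ∀ i, P' i * H * P' i = H * P' i := fun i => by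
          rw [(h5 i).eq, mul_assoc, h2]
        simp only [this]
        rw [← Finset.mul_sum, h6, mul_one])
    omega
  have hsplit : ∀ (S : A) (P'' : Fin k → A), star S = S → S * S = S → S ≠ 0 → Commute S H →
      (∀ i, S * P'' i = 0) → (∀ i, star (P'' i) = P'' i) → (∀ i, P'' i * P'' i = P'' i) →
      (∀ i j, i ≠ j → P'' i * P'' j = 0) → (∀ i, P'' i ≠ 0) → (∀ i, Commute (P'' i) H) →
      S + ∑ i, P'' i = 1 → False := by
    intro S P'' s1 s2 s3 s4 s5 h1 h2 h3 h4 h5 h6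
    have s6 : ∀ i, P'' i * S = 0 := fun i => by
      have := congrArg star (s5 i)
      simpa [s1, h1] using this
    refine hbig (Fin.cons S P'') ?_ ?_ ?_ ?_ ?_ ?_
    · intro i; refine Fin.cases ?_ (fun i => ?_) i
      · simpa using s1
      · simpa using h1 i
    · intro i; refine Fin.cases ?_ (fun i => ?_) i
      · simpa using s2
      · simpa using h2 i
    · intro i j
      refine Fin.cases ?_ (fun i => ?_) i
      · refine Fin.cases ?_ (fun j => ?_) j
        · intro h; exact absurd rfl h
        · intro _; simpa using s5 j
      · refine Fin.cases ?_ (fun j => ?_) j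
        · intro _; simpa using s6 i
        · intro h; simpa using h3 i j (fun h' => h (by rw [h']))
    · intro i; refine Fin.cases ?_ (fun i => ?_) i
      · simpa using s3
      · simpa using h4 i
    · intro i; refine Fin.cases ?_ (fun i => ?_) i
      · simpa using s4
      · simpa using h5 i
    · rw [Fin.sum_univ_succ]; simpa using h6
  have hSP : ∀ i, (∑ j, P j) * P i = P i := by
    intro i
    rw [Finset.sum_mul, Finset.sum_eq_single i]
    · exact hPP i
    · intro j _ hj; exact hPz j i hj
    · simp
  have hsum : ∑ i, P i = 1 := by
    by_contra hne
    refine hsplit (1 - ∑ i, P i) P ?_ ?_ ?_ ?_ ?_ hPsa hPP hPz hPne hPH ?_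
    · rw [star_sub, star_one, star_sum]; simp only [hPsa]
    · have : (∑ i, P i) * (∑ i, P i) = ∑ i, P i := by
        rw [Finset.mul_sum]; simp only [hSP]
      rw [sub_mul, mul_sub, mul_sub, this]; simp
    · intro h; exact hne (sub_eq_zero.1 h).symm
    · exact (Commute.one_left H).sub_left (Commute.sum_left _ _ _ fun i _ => hPH i)
    · intro i; rw [sub_mul, hSP, one_mul, sub_self]
    · abel
  refine ⟨fun i => ⟨hPP i, hPsa i, hPH i, hPne i, ?_⟩, hsum⟩
  intro e hee hes heH heP
  by_contra! hcon
  obtain ⟨he0, hei⟩ := hcon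
  have hPe : P i * e = e := by
    have := congrArg star heP
    simpa [hes, hPsa] using this
  have hej : ∀ j, j ≠ i → e * P j = 0 := fun j hj => by
    rw [← heP, mul_assoc, hPz i j hj.symm, mul_zero]
  have hje : ∀ j, j ≠ i → P j * e = 0 := fun j hj => by
    rw [← hPe, ← mul_assoc, hPz j i hj, zero_mul]
  refine hsplit e (fun j => if j = i then P i - e else P j) hes hee he0 heH ?_ ?_ ?_ ?_ ?_ ?_ ?_
  · intro j
    by_cases hj : j = i
    · simp only [hj, if_true, mul_sub, heP, hee, sub_self]
    · simp only [hj, if_false, hej j hj]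
  · intro j
    by_cases hj : j = i
    · simp only [hj, if_true, star_sub, hPsa, hes]
    · simp only [hj, if_false, hPsa]
  · intro j
    by_cases hj : j = i
    · simp only [hj, if_true, mul_sub, sub_mul, heP, hee, hPP, hPe]; abel
    · simp only [hj, if_false, hPP]
  · intro j l hjl
    by_cases hj : j = i
    · subst hj
      simp only [if_true, hjl.symm, if_false, sub_mul, hPz j l hjl, hej l hjl.symm, sub_zero]
    · by_cases hl : l = i
      · subst hl
        simp only [if_true, hj, if_false, mul_sub, hPz j l hjl, hje j hj, sub_zero]
      · simp only [hj, hl, if_false, hPz j l hjl]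
  · intro j
    by_cases hj : j = i
    · simp only [hj, if_true]; exact fun h => hei (sub_eq_zero.1 h).symm
    · simp only [hj, if_false]; exact hPne j
  · intro j
    by_cases hj : j = i
    · simp only [hj, if_true]; exact (hPH i).sub_left heH
    · simp only [hj, if_false]; exact hPH j
  · have : ∀ j, (if j = i then P i - e else P j) = P j - (if j = i then e else 0) := by
      intro j
      by_cases hj : j = i
      · simp [hj]
      · simp [hj]
    simp only [this]
    rw [Finset.sum_sub_distrib, hsum]
    simp

theorem PrimProj.conj {A : Type} [Ring A] [StarRing A] {H Q U : A} (hH : star H = H)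
    (hQ : PrimProj H Q)
    (h1 : star U * U = 1) (h2 : U * star U = 1) (hUH : Commute U H) :
    PrimProj H (U * Q * star U) := by
  obtain ⟨hQQ, hQs, hQH, hQ0, hprim⟩ := hQ
  have hUH' : Commute (star U) H := by
    have := congrArg star hUH.eq
    rw [star_mul, star_mul, hH] at this
    exact this.symm
  have hcan : ∀ x, star U * (U * x) = x := fun x => by rw [← mul_assoc, h1, one_mul]
  have hcan' : ∀ x, U * (star U * x) = x := fun x => by rw [← mul_assoc, h2, one_mul]
  refine ⟨?_, ?_, (hUH.mul_left hQH).mul_left hUH', ?_, ?_⟩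
  · simp only [mul_assoc, hcan]; rw [← mul_assoc Q Q, hQQ]
  · simp [hQs, mul_assoc]
  · intro h
    apply hQ0
    have := congrArg (fun x => star U * x * U) h
    simpa [mul_assoc, hcan, h1] using this
  · intro e hee hes heH heQ
    have hback : ∀ x, U * (star U * x * U) * star U = x := fun x => by
      simp only [mul_assoc, hcan', h2, mul_one]
    rcases hprim (star U * e * U) (by
        simp only [mul_assoc, hcan']; rw [← mul_assoc e e, hee]) (by simp [hes, mul_assoc])
      ((hUH'.mul_left heH).mul_left hUH) (by
        have := congrArg (fun x => star U * x * U) heQ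
        simpa [mul_assoc, hcan, h1] using this) with h | h
    · left; rw [← hback e, h]; simp
    · right; rw [← hback e, h]

theorem main_ring (K A : Type) [Field K] [CharZero K] (hK : GoodField K) [Ring A] [StarRing A]
    [Algebra K A] [FiniteDimensional K A] (hst : ∀ (k : K) (x : A), star (k • x) = k • star x)
    (H : A) (hH : star H = H) (k : ℕ) (P Q : Fin k → A)
    (hP : ∀ j, PrimProj H (P j)) (hQ : ∀ j, PrimProj H (Q j)) (hsum : ∑ j, Q j = 1)
    (hPz : ∀ i j, i ≠ j → P i * P j = 0) (hQz : ∀ i j, i ≠ j → Q i * Q j = 0) :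
    ∃ (σ : Equiv.Perm (Fin k)) (U : A),
      star U * U = 1 ∧ U * star U = 1 ∧ U * H * star U = H ∧
      ∀ i, U * Q i * star U = P (σ i) := by
  classical
  have hind : ∀ s : ℕ, s ≤ k → ∃ (g : Fin k → Fin k) (U : A),
      star U * U = 1 ∧ U * star U = 1 ∧ Commute U H ∧
      ∀ i : Fin k, i.val < s → U * Q (g i) * star U = P i := by
    intro s
    induction s with
    | zero => exact fun _ => ⟨id, 1, by simp, by simp, Commute.one_left H, fun i hi => by omega⟩
    | succ s ih =>
      intro hs
      obtain ⟨g, U, h1, h2, hUH, hU⟩ := ih (by omega)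
      let i₀ : Fin k := ⟨s, by omega⟩
      have hcan : ∀ x, star U * (U * x) = x := fun x => by rw [← mul_assoc, h1, one_mul]
      obtain ⟨j, r, hne, hrs, hrr, hrH, hrQ, hrx⟩ := step_lemma K A hK hst H (P i₀) hH (hP i₀) k
        (fun j => U * Q j * star U) (fun j => (hQ j).conj hH h1 h2 hUH)
        (by rw [← Finset.sum_mul, ← Finset.mul_sum, hsum, mul_one, h2])
      refine ⟨Function.update g i₀ j, r * U, ?_, ?_, hrH.mul_left hUH, ?_⟩
      · rw [star_mul, hrs, mul_assoc, ← mul_assoc r r, hrr, one_mul, h1]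
      · rw [star_mul, hrs, mul_assoc, ← mul_assoc U, h2, one_mul, hrr]
      · intro i hi
        have hform : ∀ x, r * U * x * star (r * U) = r * (U * x * star U) * r := fun x => by
          rw [star_mul, hrs]; simp only [mul_assoc]
        rw [hform]
        by_cases hii : i = i₀
        · rw [hii, Function.update_self, hrQ]
        · rw [Function.update_of_ne hii]
          have hlt : i.val < s := by
            have : i.val ≠ s := fun h => hii (Fin.ext h)
            omega
          rw [hU i hlt]
          have hgj : g i ≠ j := by
            rintro rfl
            apply hne
            show P i₀ * (U * Q (g i) * star U) = 0
            rw [hU i hlt, hPz _ _ (Ne.symm hii)]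
          have hPr : P i * r = P i := by
            refine hrx (P i) (hPz _ _ hii) ?_
            show P i * (U * Q j * star U) = 0
            rw [← hU i hlt]
            simp only [mul_assoc, hcan]
            rw [← mul_assoc (Q (g i)), hQz _ _ hgj]
            simp
          have hrP : r * P i = P i := by
            have := congrArg star hPr
            simpa [hrs, (hP i).2.1] using this
          rw [hrP, hPr]
  obtain ⟨g, U, h1, h2, hUH, hU⟩ := hind k le_rfl
  have hinj : Function.Injective g := by
    intro i j hij
    by_contra hne
    have : P i = P j := by rw [← hU i i.2, ← hU j j.2, hij]
    have h0 := hPz i j hne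
    rw [← this, (hP i).1] at h0
    exact (hP i).2.2.2.1 h0
  let e : Equiv.Perm (Fin k) := Equiv.ofBijective g (Finite.injective_iff_bijective.1 hinj)
  refine ⟨e.symm, U, h1, h2, by rw [hUH.eq, mul_assoc, h2, mul_one], fun i => ?_⟩
  rw [← hU (e.symm i) (e.symm i).2]
  have : g (e.symm i) = i := e.apply_symm_apply i
  rw [this]

theorem cancellation_implies_conjecture (R : Type) [Ring R] [Algebra ℝ R]
    [StarRing R] [FiniteDimensional ℝ R] [IsLocalRing R]
    (hcancel : ∀ (m m' : ℕ) (A A' : Matrix (Fin m) (Fin m) R)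
        (B B' : Matrix (Fin m') (Fin m') R),
        Aᴴ = A → A'ᴴ = A' → Bᴴ = B → B'ᴴ = B' →
        UnitarilySimilar A A' →
        UnitarilySimilar (Matrix.fromBlocks A 0 0 B) (Matrix.fromBlocks A' 0 0 B') →
        UnitarilySimilar B B')
    (n k : ℕ) (H : Matrix (Fin n) (Fin n) R) (hH : Hᴴ = H)
    (P Q : Fin k → Matrix (Fin n) (Fin n) R)
    (hPsa : ∀ i, (P i)ᴴ = P i)
    (hPorth : ∀ i j, P i * P j = if i = j then P i else 0)
    (hPne : ∀ i, P i ≠ 0)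
    (hPsum : H = ∑ i, P i * H * P i)
    (hQsa : ∀ i, (Q i)ᴴ = Q i)
    (hQorth : ∀ i j, Q i * Q j = if i = j then Q i else 0)
    (hQne : ∀ i, Q i ≠ 0)
    (hQsum : H = ∑ i, Q i * H * Q i)
    (hmax : ∀ (k' : ℕ) (P' : Fin k' → Matrix (Fin n) (Fin n) R),
        (∀ i, (P' i)ᴴ = P' i) →
        (∀ i j, P' i * P' j = if i = j then P' i else 0) →
        (∀ i, P' i ≠ 0) →
        H = ∑ i, P' i * H * P' i → k' ≤ k) :
    ∃ (σ : Equiv.Perm (Fin k)) (U : Matrix (Fin n) (Fin n) R),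
      Uᴴ * U = 1 ∧ U * Uᴴ = 1 ∧ U * H * Uᴴ = H ∧
      ∀ i, U * Q i * Uᴴ = P (σ i) := by
  classical
  obtain ⟨K, _, _, hc, hg, hfd, hst⟩ := exists_good_structure R
  obtain ⟨hP, -⟩ := max_lemma H k P hPsa hPorth hPne hPsum hmax
  obtain ⟨hQ, hQ1⟩ := max_lemma H k Q hQsa hQorth hQne hQsum hmax
  have hfd' : FiniteDimensional K (Matrix (Fin n) (Fin n) R) := Module.Finite.matrix
  exact main_ring K (Matrix (Fin n) (Fin n) R) hg
    (fun c x => by ext i j; simp [Matrix.star_apply, hst]) H hH k P Q hP hQ hQ1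
    (fun i j h => by rw [hPorth, if_neg h]) (fun i j h => by rw [hQorth, if_neg h])
end
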